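/- arXiv:1708.08084 — 2 statements merged into one kernel-verified Lean document; each statement's English description precedes it below -/
import Mathlib

section
/- Let p ≥ 2 and let ω be a weight on ℝ^n with [ω]_{A_p} < ∞. Then there is a constant c > 0 depending only on n such that for every ε with 0 < ε ≤ c·[ω]_{A_p}^{−1} and every cube Q₀: (1/|Q₀| ∫_{Q₀} ω^{1+ε} dx) ≤ 2 (1/|Q₀| ∫_{Q₀} ω dx)^{1+ε}. -/
open MeasureTheory ENNReal Filter Set
open scoped ENNReal NNReal

noncomputable section

/-- Euclidean space ℝⁿ. -/
abbrev Euc (n : ℕ) := EuclideanSpace ℝ (Fin n)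

/-- The axis-parallel cube with center `c` and half side-length `h`. -/
def cube {n : ℕ} (c : Euc n) (h : ℝ) : Set (Euc n) := {x | ∀ i, |x i - c i| ≤ h}

/-- A weight: a locally integrable, a.e. positive function. -/
def IsWeight {n : ℕ} (w : Euc n → ℝ) : Prop :=
  LocallyIntegrable w volume ∧ ∀ᵐ x : Euc n ∂volume, 0 < w x

/-- Average of (the nonnegative part of) `w` over the cube `cube c h`, valued in `ℝ≥0∞`. -/
def eAvg {n : ℕ} (w : Euc n → ℝ) (c : Euc n) (h : ℝ) : ℝ≥0∞ :=
  (∫⁻ x in cube c h, ENNReal.ofReal (w x)) / volume (cube c h)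

/-- Conjugate exponent `p' = p/(p-1)`. -/
def conjExp (p : ℝ) : ℝ := p / (p - 1)

/-- The `A_p` ratio over a fixed cube. -/
def apRatio {n : ℕ} (p : ℝ) (w : Euc n → ℝ) (c : Euc n) (h : ℝ) : ℝ≥0∞ :=
  eAvg w c h * (eAvg (fun x => w x ^ (1 - conjExp p)) c h) ^ (p - 1)

/-- The Muckenhoupt `A_p` constant. -/
def apConst (n : ℕ) (p : ℝ) (w : Euc n → ℝ) : ℝ≥0∞ :=
  ⨆ (c : Euc n) (h : ℝ) (_ : 0 < h), apRatio p w c h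

/-- Hardy–Littlewood maximal function (over cubes), `ℝ≥0∞`-valued. -/
def hlMax {n : ℕ} (f : Euc n → ℝ) (x : Euc n) : ℝ≥0∞ :=
  ⨆ (c : Euc n) (h : ℝ) (_ : 0 < h) (_ : x ∈ cube c h),
    (∫⁻ y in cube c h, ENNReal.ofReal |f y|) / volume (cube c h)

/-- The Fujii–Wilson `B_∞` ratio over a fixed cube. -/
def bRatio {n : ℕ} (w : Euc n → ℝ) (c : Euc n) (h : ℝ) : ℝ≥0∞ :=
  (∫⁻ x in cube c h, hlMax ((cube c h).indicator w) x) /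
    (∫⁻ x in cube c h, ENNReal.ofReal (w x))

/-- The Fujii–Wilson `B_∞` constant. -/
def bConst (n : ℕ) (w : Euc n → ℝ) : ℝ≥0∞ :=
  ⨆ (c : Euc n) (h : ℝ) (_ : 0 < h), bRatio w c h

/-- The bilinear `A_{(2,2)}` ratio over a fixed cube. -/
def a22Ratio {n : ℕ} (w1 w2 : Euc n → ℝ) (c : Euc n) (h : ℝ) : ℝ≥0∞ :=
  eAvg (fun x => w1 x ^ ((1:ℝ)/2) * w2 x ^ ((1:ℝ)/2)) c h *
    ((eAvg (fun x => (w1 x)⁻¹) c h) ^ ((1:ℝ)/2) * (eAvg (fun x => (w2 x)⁻¹) c h) ^ ((1:ℝ)/2))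

/-- The bilinear `A_{(2,2)}` constant. -/
def a22Const (n : ℕ) (w1 w2 : Euc n → ℝ) : ℝ≥0∞ :=
  ⨆ (c : Euc n) (h : ℝ) (_ : 0 < h), a22Ratio w1 w2 c h

/-- Weighted `L²` norm, `ℝ≥0∞`-valued. -/
def wL2 {n : ℕ} (w f : Euc n → ℝ) : ℝ≥0∞ :=
  (∫⁻ x, ENNReal.ofReal (f x ^ 2 * w x)) ^ ((1:ℝ)/2)

/-- Weighted `L¹` norm, `ℝ≥0∞`-valued. -/
def wL1 {n : ℕ} (w f : Euc n → ℝ) : ℝ≥0∞ :=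
  ∫⁻ x, ENNReal.ofReal (|f x| * w x)

theorem rpow_sub_rpow_mul_le {a b D ε : ℝ} (hb : 0 < b) (hba : b ≤ a) (haD : a ≤ D * b)
    (hε : 0 < ε) (hε1 : ε ≤ 1) :
    (a ^ ε - b ^ ε) * a ≤ D * ε * (a ^ (1 + ε) - b ^ (1 + ε)) := by
  have ha : 0 < a := hb.trans_le hba
  have hbe : 0 < b ^ ε := Real.rpow_pos_of_pos hb ε
  have h1 : (a / b) ^ ε ≤ 1 + ε * (a / b - 1) := by
    have := rpow_one_add_le_one_add_mul_self (s := a / b - 1) (p := ε)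
      (by have : 0 < a / b := by positivity
          linarith) hε.le hε1
    simpa using this
  have h2 : a ^ ε = b ^ ε * (a / b) ^ ε := by
    rw [← Real.mul_rpow hb.le (by positivity)]
    congr 1
    field_simp
  have hD : 0 ≤ D := by
    by_contra hD
    nlinarith
  have h3 : a ^ ε - b ^ ε ≤ b ^ ε * (ε * (a / b - 1)) := by
    rw [h2]; nlinarith
  have h4 : b ^ ε ≤ a ^ ε := Real.rpow_le_rpow hb.le hba hε.le
  rw [Real.rpow_add ha, Real.rpow_add hb, Real.rpow_one, Real.rpow_one]
  have h5 : b ^ ε * (a - b) ≤ a * a ^ ε - b * b ^ ε := by nlinarith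
  calc (a ^ ε - b ^ ε) * a ≤ b ^ ε * (ε * (a / b - 1)) * a := by gcongr
    _ = ε * (b ^ ε * (a - b)) * (a / b) := by field_simp
    _ ≤ ε * (b ^ ε * (a - b)) * D := by
        have : 0 ≤ a - b := by linarith
        gcongr
        rwa [div_le_iff₀ hb]
    _ = D * ε * (b ^ ε * (a - b)) := by ring
    _ ≤ _ := by gcongr

/-- A Bellman-type potential: `m` is the running maximum of the averages `x` of a weight, and `s`
the maximum of the averages `y` of its square root since `m` was last attained. -/
def bellman (K ε m s x y : ℝ) : ℝ :=
  m ^ ε * x + m ^ ε / 4 * (4 * x - 4 * s * y + 2 * s ^ 2) - m ^ (1 + ε) / (4 * K)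

theorem rpow_le_bellman {K ε m s x y : ℝ} (hK : 0 < K) (hε : 0 < ε) (hx : 0 < x) (hxm : x ≤ m)
    (hms : m ≤ K * s ^ 2) (hyx : y ^ 2 ≤ x) : x ^ (1 + ε) ≤ bellman K ε m s x y := by
  have hm : 0 < m := hx.trans_le hxm
  have hme : 0 < m ^ ε := Real.rpow_pos_of_pos hm ε
  have h1 : x ^ ε ≤ m ^ ε := Real.rpow_le_rpow hx.le hxm hε.le
  have h2 : m / K ≤ 4 * x - 4 * s * y + 2 * s ^ 2 := by
    have : m / K ≤ s ^ 2 := by rw [div_le_iff₀ hK]; linarith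
    nlinarith [sq_nonneg (s - 2 * y)]
  have h3 : m ^ ε / 4 * (m / K) ≤ m ^ ε / 4 * (4 * x - 4 * s * y + 2 * s ^ 2) := by gcongr
  have h4 : m ^ (1 + ε) / (4 * K) = m ^ ε / 4 * (m / K) := by
    rw [Real.rpow_add hm, Real.rpow_one]; field_simp
  have h5 : x ^ (1 + ε) = x ^ ε * x := by rw [Real.rpow_add hx, Real.rpow_one]; ring
  unfold bellman
  rw [h4, h5]
  have := mul_le_mul_of_nonneg_right h1 hx.le
  linarith

theorem bellman_max_le {K ε m s x y : ℝ} (hm : 0 < m) :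
    bellman K ε m (max s y) x y ≤ bellman K ε m s x y := by
  have hme : 0 < m ^ ε := Real.rpow_pos_of_pos hm ε
  have : 4 * x - 4 * max s y * y + 2 * max s y ^ 2 ≤ 4 * x - 4 * s * y + 2 * s ^ 2 := by
    rcases le_total s y with h | h
    · rw [max_eq_right h]; nlinarith [sq_nonneg (s - y)]
    · rw [max_eq_left h]
  unfold bellman
  gcongr

theorem bellman_reset_le {K ε m s x y D : ℝ} (hK : 1 ≤ K) (hε : 0 < ε) (hε1 : ε ≤ 1)
    (hD : 8 * D * ε * K ≤ 1) (hm : 0 < m) (hmx : m ≤ x) (hxm : x ≤ D * m) :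
    bellman K ε x y x y ≤ bellman K ε m s x y := by
  have hx : 0 < x := hm.trans_le hmx
  have hme : 0 < m ^ ε := Real.rpow_pos_of_pos hm ε
  have h1 : m ^ ε ≤ x ^ ε := Real.rpow_le_rpow hm.le hmx hε.le
  have h2 : m ^ (1 + ε) ≤ x ^ (1 + ε) := Real.rpow_le_rpow hm.le hmx (by linarith)
  have h3 := rpow_sub_rpow_mul_le hm hmx hxm hε hε1
  have h4 : 2 * D * ε ≤ 1 / (4 * K) := by
    rw [le_div_iff₀ (by positivity)]; linarith
  have h5 : 2 * D * ε * (x ^ (1 + ε) - m ^ (1 + ε)) ≤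
      1 / (4 * K) * (x ^ (1 + ε) - m ^ (1 + ε)) := by
    have : 0 ≤ x ^ (1 + ε) - m ^ (1 + ε) := by linarith
    gcongr
  have h6 : 0 ≤ m ^ ε / 2 * (s - y) ^ 2 := by positivity
  have h7 : 0 ≤ (x ^ ε - m ^ ε) * y ^ 2 := mul_nonneg (by linarith) (sq_nonneg y)
  unfold bellman
  rw [div_eq_mul_one_div (x ^ (1 + ε)), div_eq_mul_one_div (m ^ (1 + ε))]
  linarith

theorem bellman_self_le {K ε x y : ℝ} (hK : 0 < K) (hx : 0 < x) :
    bellman K ε x y x y ≤ 2 * x ^ (1 + ε) := by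
  have h5 : x ^ (1 + ε) = x ^ ε * x := by
    rw [Real.rpow_add hx, Real.rpow_one]; ring
  have hme : 0 < x ^ ε := Real.rpow_pos_of_pos hx ε
  have h6 : 0 ≤ x ^ (1 + ε) / (4 * K) := by positivity
  have h7 : 0 ≤ x ^ ε * y ^ 2 := by positivity
  unfold bellman
  linarith

section Dyadic

variable {n : ℕ}

/-- The half-open cube with center `c` and half side-length `h`. -/
def halfBox (c : Fin n → ℝ) (h : ℝ) : Set (Fin n → ℝ) :=
  univ.pi fun i => Ico (c i - h) (c i + h)

/-- The center of the child of `halfBox c h` in the orthant `σ`. -/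
def childCenter (c : Fin n → ℝ) (h : ℝ) (σ : Fin n → Bool) : Fin n → ℝ :=
  fun i => if σ i then c i + h / 2 else c i - h / 2

/-- The orthant around `c` which contains `x`. -/
def orthant (c x : Fin n → ℝ) : Fin n → Bool := fun i => decide (c i ≤ x i)

/-- Average over the half-open cube with center `c` and half side-length `h`. -/
def boxAvg (f : (Fin n → ℝ) → ℝ) (c : Fin n → ℝ) (h : ℝ) : ℝ :=
  (∫ x in halfBox c h, f x) / (2 * h) ^ n

/-- The function equal on each `N`-th generation dyadic subcube of `halfBox c h` to the average
of `f` over that subcube. -/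
def dyadicAvg (f : (Fin n → ℝ) → ℝ) :
    ℕ → (Fin n → ℝ) → ℝ → (Fin n → ℝ) → ℝ
  | 0, c, h, _ => boxAvg f c h
  | N + 1, c, h, x => dyadicAvg f N (childCenter c h (orthant c x)) (h / 2) x

theorem measurableSet_halfBox (c : Fin n → ℝ) (h : ℝ) : MeasurableSet (halfBox c h) :=
  MeasurableSet.univ_pi fun _ => measurableSet_Ico

theorem mem_halfBox_childCenter {c x : Fin n → ℝ} {h : ℝ} (hh : 0 < h) (σ : Fin n → Bool) :
    x ∈ halfBox (childCenter c h σ) (h / 2) ↔ x ∈ halfBox c h ∧ σ = orthant c x := by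
  simp only [halfBox, childCenter, orthant, mem_univ_pi, mem_Ico, funext_iff, ← forall_and]
  refine forall_congr' fun i => ?_
  by_cases hc : c i ≤ x i
  · cases σ i
    · simp only [hc, Bool.false_eq_true, if_false, decide_true, Bool.false_eq_true, and_false,
        iff_false, not_and, not_lt]
      intro; linarith
    · simp only [hc, if_true, decide_true, and_true]
      constructor <;> rintro ⟨h1, h2⟩ <;> constructor <;> linarith
  · cases σ i
    · simp only [hc, Bool.false_eq_true, if_false, decide_false, and_true]
      constructor <;> rintro ⟨h1, h2⟩ <;> constructor <;> linarith
    · simp only [hc, if_true, decide_false, Bool.true_eq_false, and_false, iff_false, not_and,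
        not_lt]
      intro; linarith

theorem iUnion_halfBox_childCenter {c : Fin n → ℝ} {h : ℝ} (hh : 0 < h) :
    ⋃ σ, halfBox (childCenter c h σ) (h / 2) = halfBox c h := by
  ext x
  simp [mem_halfBox_childCenter hh]

theorem pairwise_disjoint_halfBox_childCenter {c : Fin n → ℝ} {h : ℝ} (hh : 0 < h) :
    Pairwise (Function.onFun Disjoint fun σ => halfBox (childCenter c h σ) (h / 2)) := by
  intro σ τ hστ
  refine Set.disjoint_left.2 fun x hx hx' => hστ ?_
  rw [mem_halfBox_childCenter hh] at hx hx'
  rw [hx.2, hx'.2]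

theorem halfBox_ae_eq_closedBall {c : Fin n → ℝ} {h : ℝ} (hh : 0 ≤ h) :
    halfBox c h =ᵐ[volume] Metric.closedBall c h := by
  have := Measure.univ_pi_Ico_ae_eq_Icc (μ := fun _ : Fin n => (volume : Measure ℝ))
    (f := fun i => c i - h) (g := fun i => c i + h)
  have e : Metric.closedBall c h = Icc (fun i => c i - h) fun i => c i + h := by
    rw [closedBall_pi c hh]
    simp only [Real.closedBall_eq_Icc, pi_univ_Icc]
  rw [e]
  exact this

theorem volume_halfBox {c : Fin n → ℝ} {h : ℝ} (hh : 0 ≤ h) :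
    volume (halfBox c h) = ENNReal.ofReal ((2 * h) ^ n) := by
  rw [measure_congr (halfBox_ae_eq_closedBall hh), Real.volume_pi_closedBall _ hh,
    Fintype.card_fin]

theorem integrableOn_halfBox {f : (Fin n → ℝ) → ℝ} (hf : LocallyIntegrable f) (c : Fin n → ℝ)
    {h : ℝ} (hh : 0 ≤ h) : IntegrableOn f (halfBox c h) :=
  (hf.integrableOn_isCompact (isCompact_closedBall c h)).congr_set_ae (halfBox_ae_eq_closedBall hh)

theorem boxAvg_eq_sum {f : (Fin n → ℝ) → ℝ} (hf : LocallyIntegrable f) (c : Fin n → ℝ) {h : ℝ}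
    (hh : 0 < h) :
    boxAvg f c h = (∑ σ, boxAvg f (childCenter c h σ) (h / 2)) / 2 ^ n := by
  unfold boxAvg
  rw [← iUnion_halfBox_childCenter hh, integral_iUnion_fintype
    (fun σ => measurableSet_halfBox _ _) (pairwise_disjoint_halfBox_childCenter hh)
    (fun σ => integrableOn_halfBox hf _ (by positivity)), ← Finset.sum_div]
  rw [div_div, ← mul_pow]
  congr 2
  ring

theorem measurable_orthant (c : Fin n → ℝ) : Measurable (orthant c) := by
  refine measurable_pi_lambda _ fun i => ?_
  refine measurable_to_bool ?_
  have : (fun x => orthant c x i) ⁻¹' {true} = {x | c i ≤ x i} := by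
    ext x; simp [orthant]
  rw [this]
  exact measurableSet_le measurable_const (measurable_pi_apply i)

theorem measurable_dyadicAvg (f : (Fin n → ℝ) → ℝ) (N : ℕ) (c : Fin n → ℝ) (h : ℝ) :
    Measurable (dyadicAvg f N c h) := by
  induction N generalizing c h with
  | zero => exact measurable_const
  | succ N ih =>
    have : Measurable fun q : (Fin n → ℝ) × (Fin n → Bool) =>
        dyadicAvg f N (childCenter c h q.2) (h / 2) q.1 :=
      measurable_from_prod_countable_left fun σ => ih (childCenter c h σ) (h / 2)
    exact this.comp (measurable_id.prodMk (measurable_orthant c))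

theorem exists_dyadicAvg_eq (f : (Fin n → ℝ) → ℝ) (N : ℕ) {c x : Fin n → ℝ} {h : ℝ} (hh : 0 < h)
    (hx : x ∈ halfBox c h) :
    ∃ c', x ∈ halfBox c' (h / 2 ^ N) ∧ dyadicAvg f N c h x = boxAvg f c' (h / 2 ^ N) := by
  induction N generalizing c h with
  | zero => exact ⟨c, by simpa using hx, by simp [dyadicAvg]⟩
  | succ N ih =>
    have e : h / 2 / 2 ^ N = h / 2 ^ (N + 1) := by rw [div_div, pow_succ']
    rw [← e]
    exact ih (half_pos hh) ((mem_halfBox_childCenter hh _).2 ⟨hx, rfl⟩)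

theorem ae_tendsto_dyadicAvg {f : (Fin n → ℝ) → ℝ} (hf : LocallyIntegrable f) (c : Fin n → ℝ)
    {h : ℝ} (hh : 0 < h) :
    ∀ᵐ x, x ∈ halfBox c h → Tendsto (fun N => dyadicAvg f N c h x) atTop (nhds (f x)) := by
  filter_upwards [IsUnifLocDoublingMeasure.ae_tendsto_average volume hf 1] with x hx hxc
  choose c' hc' he using fun N => exists_dyadicAvg_eq f N hh hxc
  have hpos : ∀ N : ℕ, 0 < h / 2 ^ N := fun N => by positivity
  have hlim : Tendsto (fun N : ℕ => h / 2 ^ N) atTop (nhdsWithin 0 (Ioi 0)) := by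
    refine tendsto_nhdsWithin_iff.2 ⟨?_, .of_forall hpos⟩
    have := (tendsto_pow_atTop_nhds_zero_of_lt_one (r := (1 / 2 : ℝ)) (by norm_num)
      (by norm_num)).const_mul h
    simpa [div_eq_mul_inv] using this
  have := hx c' (fun N => h / 2 ^ N) hlim (.of_forall fun N => by
    rw [one_mul, closedBall_pi _ (hpos N).le]
    intro i _
    change x i ∈ Metric.closedBall (c' N i) (h / 2 ^ N)
    rw [Real.closedBall_eq_Icc]
    exact Ico_subset_Icc_self (hc' N i trivial))
  refine this.congr fun N => ?_
  rw [he, setAverage_eq, boxAvg, measureReal_def, Real.volume_pi_closedBall _ (hpos N).le,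
    setIntegral_congr_set (halfBox_ae_eq_closedBall (hpos N).le), Fintype.card_fin,
    ENNReal.toReal_ofReal (by positivity), smul_eq_mul, inv_mul_eq_div]

theorem setLIntegral_dyadicAvg_le {v u : (Fin n → ℝ) → ℝ} (hv : LocallyIntegrable v)
    (hu : LocallyIntegrable u) {K ε : ℝ} (hK : 1 ≤ K) (hε : 0 < ε) (hε1 : ε ≤ 1)
    (hKε : 8 * 2 ^ n * ε * K ≤ 1)
    (hpos : ∀ c h, 0 < h → 0 < boxAvg v c h)
    (hu0 : ∀ c h, 0 < h → 0 ≤ boxAvg u c h)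
    (hle : ∀ c h, 0 < h → boxAvg u c h ^ 2 ≤ boxAvg v c h)
    (hge : ∀ c h, 0 < h → boxAvg v c h ≤ K * boxAvg u c h ^ 2)
    (N : ℕ) (c : Fin n → ℝ) {h m s : ℝ} (hh : 0 < h) (hm : boxAvg v c h ≤ m)
    (hs : 0 ≤ s) (hms : m ≤ K * s ^ 2) :
    ∫⁻ x in halfBox c h, ENNReal.ofReal (dyadicAvg v N c h x ^ (1 + ε)) ≤
      ENNReal.ofReal ((2 * h) ^ n * bellman K ε m s (boxAvg v c h) (boxAvg u c h)) := by
  have hK0 : 0 < K := by linarith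
  induction N generalizing c h m s with
  | zero =>
    simp only [dyadicAvg, lintegral_const, Measure.restrict_apply_univ, volume_halfBox hh.le]
    rw [mul_comm, ← ENNReal.ofReal_mul (by positivity)]
    gcongr
    exact rpow_le_bellman hK0 hε (hpos c h hh) hm hms (hle c h hh)
  | succ N ih =>
    have hm0 : 0 < m := (hpos c h hh).trans_le hm
    have hh2 := half_pos hh
    set X := fun σ => boxAvg v (childCenter c h σ) (h / 2) with hX
    set Y := fun σ => boxAvg u (childCenter c h σ) (h / 2) with hY
    have hXD : ∀ σ, X σ ≤ 2 ^ n * m := fun σ => by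
      have h1 : X σ ≤ ∑ σ, X σ :=
        Finset.single_le_sum (f := X) (fun τ _ => (hpos _ _ hh2).le) (Finset.mem_univ σ)
      have h2 := boxAvg_eq_sum hv c hh
      rw [_root_.eq_div_iff (by positivity)] at h2
      calc X σ ≤ boxAvg v c h * 2 ^ n := by rw [h2]; exact h1
        _ ≤ m * 2 ^ n := by gcongr
        _ = _ := mul_comm _ _
    have key : ∀ σ, ∃ m' s', X σ ≤ m' ∧ 0 ≤ s' ∧ m' ≤ K * s' ^ 2 ∧
        bellman K ε m' s' (X σ) (Y σ) ≤ bellman K ε m s (X σ) (Y σ) := fun σ => by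
      rcases le_total (X σ) m with hσ | hσ
      · refine ⟨m, max s (Y σ), hσ, le_max_of_le_left hs, hms.trans ?_, bellman_max_le hm0⟩
        gcongr
        exact le_max_left _ _
      · exact ⟨X σ, Y σ, le_rfl, hu0 _ _ hh2, hge _ _ hh2,
          bellman_reset_le hK hε hε1 hKε hm0 hσ (hXD σ)⟩
    have hchild : ∀ σ, ∫⁻ x in halfBox (childCenter c h σ) (h / 2),
        ENNReal.ofReal (dyadicAvg v (N + 1) c h x ^ (1 + ε)) ≤
        ENNReal.ofReal (h ^ n * bellman K ε m s (X σ) (Y σ)) := fun σ => by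
      obtain ⟨m', s', h1, h2, h3, h4⟩ := key σ
      have e : ∀ x ∈ halfBox (childCenter c h σ) (h / 2),
          ENNReal.ofReal (dyadicAvg v (N + 1) c h x ^ (1 + ε)) =
          ENNReal.ofReal (dyadicAvg v N (childCenter c h σ) (h / 2) x ^ (1 + ε)) := by
        intro x hx
        rw [dyadicAvg, ← ((mem_halfBox_childCenter hh σ).1 hx).2]
      rw [setLIntegral_congr_fun (measurableSet_halfBox _ _) e]
      refine (ih (childCenter c h σ) hh2 h1 h2 h3).trans ?_
      rw [mul_div_cancel₀ h two_ne_zero]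
      gcongr
    have hnn : ∀ σ, 0 ≤ h ^ n * bellman K ε m s (X σ) (Y σ) := fun σ => by
      obtain ⟨m', s', h1, h2, h3, h4⟩ := key σ
      have := rpow_le_bellman hK0 hε (hpos _ _ hh2) h1 h3 (hle (childCenter c h σ) _ hh2)
      have := (Real.rpow_pos_of_pos (hpos (childCenter c h σ) _ hh2) (1 + ε)).le
      have : 0 ≤ bellman K ε m s (X σ) (Y σ) := by linarith
      positivity
    rw [← iUnion_halfBox_childCenter hh, lintegral_iUnion (fun σ => measurableSet_halfBox _ _)
      (pairwise_disjoint_halfBox_childCenter hh), tsum_fintype]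
    refine (Finset.sum_le_sum fun σ _ => hchild σ).trans ?_
    rw [← ENNReal.ofReal_sum_of_nonneg fun σ _ => hnn σ]
    refine ENNReal.ofReal_le_ofReal (le_of_eq ?_)
    rw [boxAvg_eq_sum hv c hh, boxAvg_eq_sum hu c hh]
    have e : ∀ x y, bellman K ε m s x y = 2 * m ^ ε * x - m ^ ε * s * y +
        (m ^ ε / 2 * s ^ 2 - m ^ (1 + ε) / (4 * K)) := fun x y => by unfold bellman; ring
    simp only [e, ← Finset.mul_sum, Finset.sum_add_distrib, Finset.sum_sub_distrib,
      Finset.sum_const, Finset.card_univ, Fintype.card_fun, Fintype.card_bool, Fintype.card_fin,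
      nsmul_eq_mul, mul_pow, hX, hY]
    push_cast
    field_simp

theorem setLIntegral_rpow_le {v u : (Fin n → ℝ) → ℝ} (hv : LocallyIntegrable v)
    (hu : LocallyIntegrable u) {K ε : ℝ} (hK : 1 ≤ K) (hε : 0 < ε) (hε1 : ε ≤ 1)
    (hKε : 8 * 2 ^ n * ε * K ≤ 1)
    (hpos : ∀ c h, 0 < h → 0 < boxAvg v c h)
    (hu0 : ∀ c h, 0 < h → 0 ≤ boxAvg u c h)
    (hle : ∀ c h, 0 < h → boxAvg u c h ^ 2 ≤ boxAvg v c h)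
    (hge : ∀ c h, 0 < h → boxAvg v c h ≤ K * boxAvg u c h ^ 2)
    (c : Fin n → ℝ) {h : ℝ} (hh : 0 < h) :
    ∫⁻ x in halfBox c h, ENNReal.ofReal (v x ^ (1 + ε)) ≤
      ENNReal.ofReal ((2 * h) ^ n * (2 * boxAvg v c h ^ (1 + ε))) := by
  calc ∫⁻ x in halfBox c h, ENNReal.ofReal (v x ^ (1 + ε))
      = ∫⁻ x in halfBox c h,
          liminf (fun N => ENNReal.ofReal (dyadicAvg v N c h x ^ (1 + ε))) atTop := by
        refine setLIntegral_congr_fun_ae (measurableSet_halfBox c h) ?_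
        filter_upwards [ae_tendsto_dyadicAvg hv c hh] with x hx hxc
        exact ((ENNReal.continuous_ofReal.tendsto _).comp
          ((hx hxc).rpow_const (Or.inr (by linarith)))).liminf_eq.symm
    _ ≤ liminf (fun N => ∫⁻ x in halfBox c h,
          ENNReal.ofReal (dyadicAvg v N c h x ^ (1 + ε))) atTop :=
        lintegral_liminf_le fun N => ((measurable_dyadicAvg v N c h).pow_const _).ennreal_ofReal
    _ ≤ _ := by
        refine liminf_le_of_le (by isBoundedDefault) fun b hb => ?_
        obtain ⟨N, hN⟩ := hb.exists
        refine hN.trans ((setLIntegral_dyadicAvg_le hv hu hK hε hε1 hKε hpos hu0 hle hge N c hh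
          le_rfl (hu0 c h hh) (hge c h hh)).trans ?_)
        gcongr
        exact bellman_self_le (by linarith) (hpos c h hh)

end Dyadic

section Holder

variable {α : Type*} [MeasurableSpace α] {ν : Measure α} [IsProbabilityMeasure ν] {w : α → ℝ}

theorem sq_lintegral_rpow_half_le (hw : AEMeasurable w ν) (hpos : ∀ᵐ x ∂ν, 0 < w x) :
    (∫⁻ x, ENNReal.ofReal (w x ^ (1 / 2 : ℝ)) ∂ν) ^ 2 ≤ ∫⁻ x, ENNReal.ofReal (w x) ∂ν := by
  have key := ENNReal.lintegral_mul_norm_pow_le (μ := ν) (f := fun x => ENNReal.ofReal (w x))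
    (g := fun _ => 1) hw.ennreal_ofReal aemeasurable_const (p := 1 / 2) (q := 1 / 2)
    (by norm_num) (by norm_num) (by norm_num)
  have e : ∫⁻ x, ENNReal.ofReal (w x ^ (1 / 2 : ℝ)) ∂ν =
      ∫⁻ x, ENNReal.ofReal (w x) ^ (1 / 2 : ℝ) * 1 ^ (1 / 2 : ℝ) ∂ν := by
    refine lintegral_congr_ae ?_
    filter_upwards [hpos] with x hx
    rw [ENNReal.ofReal_rpow_of_pos hx, ENNReal.one_rpow, mul_one]
  rw [← e] at key
  simp only [lintegral_const, measure_univ, mul_one, ENNReal.one_rpow] at key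
  calc _ ≤ ((∫⁻ x, ENNReal.ofReal (w x) ∂ν) ^ (1 / 2 : ℝ)) ^ 2 := by gcongr
    _ = _ := by rw [← ENNReal.rpow_natCast, ← ENNReal.rpow_mul]; norm_num

theorem one_le_lintegral_rpow_mul_sq (hw : AEMeasurable w ν) (hpos : ∀ᵐ x ∂ν, 0 < w x) {p : ℝ}
    (hp : 1 < p) :
    1 ≤ (∫⁻ x, ENNReal.ofReal (w x ^ (1 - conjExp p)) ∂ν) ^ (p - 1) *
      (∫⁻ x, ENNReal.ofReal (w x ^ (1 / 2 : ℝ)) ∂ν) ^ 2 := by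
  have hp1 : 0 < p - 1 := by linarith
  have hp2 : 0 < p + 1 := by linarith
  have key := ENNReal.lintegral_mul_norm_pow_le (μ := ν)
    (f := fun x => ENNReal.ofReal (w x ^ (1 - conjExp p)))
    (g := fun x => ENNReal.ofReal (w x ^ (1 / 2 : ℝ)))
    (hw.pow_const _).ennreal_ofReal (hw.pow_const _).ennreal_ofReal
    (p := (p - 1) / (p + 1)) (q := 2 / (p + 1)) (by positivity) (by positivity)
    (by field_simp; ring)
  have e : ∫⁻ x, ENNReal.ofReal (w x ^ (1 - conjExp p)) ^ ((p - 1) / (p + 1)) *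
      ENNReal.ofReal (w x ^ (1 / 2 : ℝ)) ^ (2 / (p + 1)) ∂ν = 1 := by
    have : ∀ᵐ x ∂ν, ENNReal.ofReal (w x ^ (1 - conjExp p)) ^ ((p - 1) / (p + 1)) *
        ENNReal.ofReal (w x ^ (1 / 2 : ℝ)) ^ (2 / (p + 1)) = 1 := by
      filter_upwards [hpos] with x hx
      rw [ENNReal.ofReal_rpow_of_pos (Real.rpow_pos_of_pos hx _),
        ENNReal.ofReal_rpow_of_pos (Real.rpow_pos_of_pos hx _),
        ← ENNReal.ofReal_mul (by positivity), ← Real.rpow_mul hx.le, ← Real.rpow_mul hx.le,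
        ← Real.rpow_add hx]
      have : (1 - conjExp p) * ((p - 1) / (p + 1)) + 1 / 2 * (2 / (p + 1)) = 0 := by
        unfold conjExp; field_simp; ring
      rw [this, Real.rpow_zero, ENNReal.ofReal_one]
    rw [lintegral_congr_ae this]
    simp
  rw [e] at key
  have := ENNReal.rpow_le_rpow key hp2.le
  rw [ENNReal.one_rpow, ENNReal.mul_rpow_of_nonneg _ _ hp2.le, ← ENNReal.rpow_mul,
    ← ENNReal.rpow_mul, div_mul_cancel₀ _ hp2.ne', div_mul_cancel₀ _ hp2.ne',
    ENNReal.rpow_two] at this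
  exact this

end Holder

section Transport

variable {n : ℕ}

theorem measurableSet_cube (c : Euc n) (h : ℝ) : MeasurableSet (cube c h) := by
  have : cube c h = ⋂ i, {x : Euc n | |x i - c i| ≤ h} := by ext x; simp [cube]
  rw [this]
  exact MeasurableSet.iInter fun i => measurableSet_le (by fun_prop) measurable_const

theorem toLp_preimage_cube (c : Euc n) {h : ℝ} (hh : 0 ≤ h) :
    WithLp.toLp 2 ⁻¹' cube c h = Metric.closedBall c.ofLp h := by
  ext x
  simp [cube, dist_pi_le_iff hh, Real.dist_eq]

theorem setLIntegral_cube (f : Euc n → ℝ≥0∞) (c : Euc n) {h : ℝ} (hh : 0 ≤ h) :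
    ∫⁻ x in cube c h, f x = ∫⁻ x in halfBox c.ofLp h, f (WithLp.toLp 2 x) := by
  rw [← (PiLp.volume_preserving_toLp (Fin n)).setLIntegral_comp_preimage_emb
    (MeasurableEquiv.toLp 2 _).measurableEmbedding, toLp_preimage_cube c hh,
    setLIntegral_congr (halfBox_ae_eq_closedBall hh)]

theorem volume_cube (c : Euc n) {h : ℝ} (hh : 0 ≤ h) :
    volume (cube c h) = ENNReal.ofReal ((2 * h) ^ n) := by
  rw [← (PiLp.volume_preserving_toLp (Fin n)).measure_preimage
    (measurableSet_cube c h).nullMeasurableSet, toLp_preimage_cube c hh,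
    ← measure_congr (halfBox_ae_eq_closedBall hh), volume_halfBox hh]

theorem eAvg_eq_lintegral_cond (w : Euc n → ℝ) (c : Euc n) (h : ℝ) :
    eAvg w c h = ∫⁻ x, ENNReal.ofReal (w x) ∂(ProbabilityTheory.cond volume (cube c h)) := by
  rw [eAvg, ProbabilityTheory.cond, lintegral_smul_measure, ENNReal.div_eq_inv_mul, smul_eq_mul]

theorem isProbabilityMeasure_cond_cube (c : Euc n) {h : ℝ} (hh : 0 < h) :
    IsProbabilityMeasure (ProbabilityTheory.cond volume (cube c h)) := by
  refine ProbabilityTheory.cond_isProbabilityMeasure_of_finite ?_ ?_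
  · rw [volume_cube c hh.le, ne_eq, ENNReal.ofReal_eq_zero, not_le]
    positivity
  · rw [volume_cube c hh.le]
    exact ENNReal.ofReal_ne_top

theorem MeasureTheory.LocallyIntegrable.comp_toLp {w : Euc n → ℝ} (hw : LocallyIntegrable w) :
    LocallyIntegrable fun x : Fin n → ℝ => w (WithLp.toLp 2 x) := by
  rw [locallyIntegrable_iff]
  intro k hk
  have hc : IsCompact (WithLp.toLp 2 '' k : Set (Euc n)) :=
    hk.image (PiLp.continuous_toLp 2 _)
  have := ((PiLp.volume_preserving_toLp (Fin n)).integrableOn_comp_preimage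
    (MeasurableEquiv.toLp 2 _).measurableEmbedding).2 (hw.integrableOn_isCompact hc)
  rwa [preimage_image_eq _ (WithLp.toLp_injective 2)] at this

theorem MeasureTheory.LocallyIntegrable.rpow_half {w : Euc n → ℝ} (hw : LocallyIntegrable w) :
    LocallyIntegrable fun x => w x ^ (1 / 2 : ℝ) := by
  refine LocallyIntegrable.mono (f := fun x => 1 + ‖w x‖)
    ((locallyIntegrable_const (1 : ℝ)).add fun x => (hw x).norm)
    (hw.aestronglyMeasurable.aemeasurable.pow_const _).aestronglyMeasurable (.of_forall fun x => ?_)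
  rw [Real.norm_of_nonneg (by positivity : 0 ≤ 1 + ‖w x‖)]
  refine (Real.abs_rpow_le_abs_rpow _ _).trans ?_
  rw [← Real.sqrt_eq_rpow, Real.norm_eq_abs, Real.sqrt_le_left (by positivity)]
  nlinarith [abs_nonneg (w x)]

theorem boxAvg_nonneg {f : (Fin n → ℝ) → ℝ} (hf : ∀ᵐ x, 0 ≤ f x) (c : Fin n → ℝ) {h : ℝ}
    (hh : 0 ≤ h) : 0 ≤ boxAvg f c h :=
  div_nonneg (integral_nonneg_of_ae (ae_restrict_of_ae hf)) (by positivity)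

theorem boxAvg_pos {f : (Fin n → ℝ) → ℝ} (hf : LocallyIntegrable f) (hpos : ∀ᵐ x, 0 < f x)
    (c : Fin n → ℝ) {h : ℝ} (hh : 0 < h) : 0 < boxAvg f c h := by
  refine div_pos ?_ (by positivity)
  rw [setIntegral_pos_iff_support_of_nonneg_ae (ae_restrict_of_ae (hpos.mono fun x hx => hx.le))
    (integrableOn_halfBox hf c hh.le)]
  have hs : (Function.support f : Set _) =ᵐ[volume] univ :=
    eventuallyEq_univ.2 (hpos.mono fun x hx => hx.ne')
  rw [measure_congr (hs.inter (ae_eq_refl (halfBox c h))), univ_inter, volume_halfBox hh.le,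
    ENNReal.ofReal_pos]
  positivity

theorem eAvg_eq_ofReal_boxAvg {w : Euc n → ℝ} (hw : LocallyIntegrable w)
    (h0 : ∀ᵐ x : Fin n → ℝ, 0 ≤ w (WithLp.toLp 2 x)) (c : Euc n) {h : ℝ} (hh : 0 < h) :
    eAvg w c h = ENNReal.ofReal (boxAvg (fun x => w (WithLp.toLp 2 x)) c.ofLp h) := by
  rw [eAvg, setLIntegral_cube _ c hh.le, volume_cube c hh.le, boxAvg,
    ENNReal.ofReal_div_of_pos (by positivity), ofReal_integral_eq_lintegral_ofReal
    (integrableOn_halfBox hw.comp_toLp _ hh.le) (ae_restrict_of_ae h0)]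

theorem IsWeight.sq_eAvg_rpow_half_le {w : Euc n → ℝ} (hw : IsWeight w) (c : Euc n) {h : ℝ}
    (hh : 0 < h) : eAvg (fun x => w x ^ (1 / 2 : ℝ)) c h ^ 2 ≤ eAvg w c h := by
  have := isProbabilityMeasure_cond_cube c hh
  have hac : ProbabilityTheory.cond volume (cube c h) ≪ volume :=
    ProbabilityTheory.cond_absolutelyContinuous
  simp only [eAvg_eq_lintegral_cond]
  exact sq_lintegral_rpow_half_le (hw.1.aestronglyMeasurable.aemeasurable.mono_ac hac)
    (hac.ae_le hw.2)

theorem IsWeight.eAvg_le {w : Euc n → ℝ} (hw : IsWeight w) {p : ℝ} (hp : 1 < p) (c : Euc n)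
    {h : ℝ} (hh : 0 < h) :
    eAvg w c h ≤ apConst n p w * eAvg (fun x => w x ^ (1 / 2 : ℝ)) c h ^ 2 := by
  have := isProbabilityMeasure_cond_cube c hh
  have hac : ProbabilityTheory.cond volume (cube c h) ≪ volume :=
    ProbabilityTheory.cond_absolutelyContinuous
  have key := one_le_lintegral_rpow_mul_sq (hw.1.aestronglyMeasurable.aemeasurable.mono_ac hac)
    (hac.ae_le hw.2) hp
  simp only [← eAvg_eq_lintegral_cond] at key
  have hap : apRatio p w c h ≤ apConst n p w :=
    le_iSup₂_of_le c h (le_iSup_of_le hh le_rfl)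
  calc eAvg w c h ≤ eAvg w c h * _ := le_mul_of_one_le_right' key
    _ = apRatio p w c h * eAvg (fun x => w x ^ (1 / 2 : ℝ)) c h ^ 2 := by
        rw [apRatio, mul_assoc]
    _ ≤ _ := by gcongr

end Transport

/-- Reverse Hölder inequality for `A_p` weights, `p ≥ 2`.
There is `c > 0` depending only on `n` such that for every `p ≥ 2`, every `ω ∈ A_p`,
every `0 < ε ≤ c·[ω]_{A_p}^{-1}` and every cube `Q₀`,
`⨍_{Q₀} ω^{1+ε} ≤ 2 (⨍_{Q₀} ω)^{1+ε}`. -/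
theorem reverse_holder_Ap (n : ℕ) :
    ∃ c : ℝ, 0 < c ∧
      ∀ p : ℝ, 2 ≤ p → ∀ w : Euc n → ℝ, IsWeight w → apConst n p w < ⊤ →
        ∀ ε : ℝ, 0 < ε → ε ≤ c * ((apConst n p w).toReal)⁻¹ →
          ∀ (c₀ : Euc n) (h : ℝ), 0 < h →
            eAvg (fun x => w x ^ (1 + ε)) c₀ h ≤ 2 * (eAvg w c₀ h) ^ (1 + ε) := by
  refine ⟨1 / (8 * 2 ^ n), by positivity, ?_⟩
  intro p hp w hw hap ε hε hεc c₀ h hh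
  set K := (apConst n p w).toReal with hKdef
  set v : (Fin n → ℝ) → ℝ := fun x => w (WithLp.toLp 2 x) with hvdef
  set u : (Fin n → ℝ) → ℝ := fun x => w (WithLp.toLp 2 x) ^ (1 / 2 : ℝ) with hudef
  have hv : LocallyIntegrable v := hw.1.comp_toLp
  have hu : LocallyIntegrable u :=
    hw.1.rpow_half.comp_toLp
  have hvpos : ∀ᵐ x, 0 < v x :=
    (PiLp.volume_preserving_toLp (Fin n)).quasiMeasurePreserving.ae hw.2
  have hv0 : ∀ᵐ x, 0 ≤ v x := hvpos.mono fun x hx => hx.le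
  have hu0 : ∀ᵐ x, 0 ≤ u x := hv0.mono fun x hx => Real.rpow_nonneg hx _
  have hvavg : ∀ c : Fin n → ℝ, ∀ h, 0 < h →
      eAvg w (WithLp.toLp 2 c) h = ENNReal.ofReal (boxAvg v c h) :=
    fun c h hh => eAvg_eq_ofReal_boxAvg hw.1 hv0 _ hh
  have huavg : ∀ c : Fin n → ℝ, ∀ h, 0 < h →
      eAvg (fun x => w x ^ (1 / 2 : ℝ)) (WithLp.toLp 2 c) h = ENNReal.ofReal (boxAvg u c h) :=
    fun c h hh => eAvg_eq_ofReal_boxAvg hw.1.rpow_half hu0 _ hh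
  have hpos : ∀ c h, 0 < h → 0 < boxAvg v c h := fun c h hh => boxAvg_pos hv hvpos c hh
  have hunn : ∀ c h, 0 < h → 0 ≤ boxAvg u c h := fun c h hh => boxAvg_nonneg hu0 c hh.le
  have hle : ∀ c h, 0 < h → boxAvg u c h ^ 2 ≤ boxAvg v c h := fun c h hh => by
    have := hw.sq_eAvg_rpow_half_le (WithLp.toLp 2 c) hh
    rwa [hvavg c h hh, huavg c h hh, ← ENNReal.ofReal_pow (hunn c h hh),
      ENNReal.ofReal_le_ofReal_iff (hpos c h hh).le] at this
  have hge : ∀ c h, 0 < h → boxAvg v c h ≤ K * boxAvg u c h ^ 2 := fun c h hh => by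
    have := hw.eAvg_le (by linarith : 1 < p) (WithLp.toLp 2 c) hh
    rwa [hvavg c h hh, huavg c h hh, ← ENNReal.ofReal_pow (hunn c h hh),
      ← ENNReal.ofReal_toReal hap.ne, ← ENNReal.ofReal_mul ENNReal.toReal_nonneg,
      ENNReal.ofReal_le_ofReal_iff (by positivity)] at this
  have hK : 1 ≤ K := by
    have h1 := hpos 0 1 one_pos
    have h2 := (hge 0 1 one_pos).trans
      (mul_le_mul_of_nonneg_left (hle 0 1 one_pos) ENNReal.toReal_nonneg)
    exact (le_mul_iff_one_le_left h1).1 h2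
  have hK0 : 0 < K := by linarith
  have hKε : 8 * 2 ^ n * ε * K ≤ 1 := by
    rw [← div_eq_mul_inv, div_div, le_div_iff₀ (by positivity)] at hεc
    linarith
  have hε1 : ε ≤ 1 := by
    have h2 : (1 : ℝ) ≤ 2 ^ n := one_le_pow₀ one_le_two
    have h8 : 1 ≤ 8 * 2 ^ n * K := by nlinarith
    nlinarith
  have main := setLIntegral_rpow_le hv hu hK hε hε1 hKε hpos hunn hle hge c₀.ofLp hh
  have hV : 0 < (2 * h) ^ n := by positivity
  have hx := hpos c₀.ofLp h hh
  have e := hvavg c₀.ofLp h hh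
  rw [WithLp.toLp_ofLp] at e
  rw [e, eAvg, setLIntegral_cube _ c₀ hh.le, volume_cube c₀ hh.le]
  refine ENNReal.div_le_of_le_mul (main.trans_eq ?_)
  rw [ENNReal.ofReal_rpow_of_pos hx, ENNReal.ofReal_mul hV.le, ENNReal.ofReal_mul zero_le_two,
    ENNReal.ofReal_ofNat, mul_comm]
end
end

section
/- Let m ≥ 1, let 1 < p₁, …, p_m < ∞, let 1/p = Σ_{j=1}^m 1/p_j, and let ω₁, …, ω_m be weights on ℝ^n with ν = ∏_{j=1}^m ω_j^{p/p_j}. Then the vector weight ω⃗ = (ω₁,…,ω_m) satisfies the A_{P⃗} condition (i.e. sup over cubes Q of (1/|Q| ∫_Q ν)^{1/p} ∏_{j=1}^m (1/|Q| ∫_Q ω_j^{1−p_j'})^{1/p_j'} < ∞) if and only if ω_j^{1−p_j'} ∈ A_{m p_j'} for every j = 1, …, m and ν ∈ A_{mp}. -/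
open MeasureTheory ENNReal Filter Set
open scoped ENNReal NNReal

noncomputable section

/-- The multiple-weight `A_{P⃗}` ratio over a fixed cube:
`(⨍_Q ν)^{1/p} ∏_j (⨍_Q ω_j^{1-p_j'})^{1/p_j'}` where `ν = ∏_j ω_j^{p/p_j}`. -/
def multiRatio {n : ℕ} {m : ℕ} (p : Fin m → ℝ) (p₀ : ℝ) (w : Fin m → Euc n → ℝ)
    (c : Euc n) (h : ℝ) : ℝ≥0∞ :=
  (eAvg (fun x => ∏ j, w j x ^ (p₀ / p j)) c h) ^ (1 / p₀) *
    ∏ j, (eAvg (fun x => w j x ^ (1 - conjExp (p j))) c h) ^ (conjExp (p j))⁻¹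

/-- The multiple-weight `A_{P⃗}` constant (in the form `[ω⃗]_{A_{P⃗}}^{1/p}`). -/
def multiConst (n : ℕ) {m : ℕ} (p : Fin m → ℝ) (p₀ : ℝ) (w : Fin m → Euc n → ℝ) : ℝ≥0∞ :=
  ⨆ (c : Euc n) (h : ℝ) (_ : 0 < h), multiRatio p p₀ w c h

lemma volume_cube_ne_zero {n : ℕ} (c : Euc n) {h : ℝ} (hh : 0 < h) :
    volume (cube c h) ≠ 0 := by
  have hsub : Metric.ball c h ⊆ cube c h := by
    intro x hx i
    rw [Metric.mem_ball, dist_eq_norm] at hx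
    exact (PiLp.norm_apply_le (x - c) i).trans hx.le
  exact ((Metric.measure_ball_pos volume c hh).trans_le (measure_mono hsub)).ne'

lemma volume_cube_ne_top {n : ℕ} (c : Euc n) (h : ℝ) : volume (cube c h) ≠ ⊤ := by
  have hsub : cube c h ⊆ (EuclideanSpace.equiv (Fin n) ℝ) ⁻¹' Set.Icc (fun i => c i - h)
      (fun i => c i + h) := by
    intro x hx
    refine ⟨fun i => ?_, fun i => ?_⟩
    · have := abs_le.mp (hx i)
      change c i - h ≤ x i
      linarith
    · have := abs_le.mp (hx i)
      change x i ≤ c i + h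
      linarith
  have hcomp : IsCompact ((EuclideanSpace.equiv (Fin n) ℝ) ⁻¹' Set.Icc (fun i => c i - h)
      (fun i => c i + h)) :=
    (EuclideanSpace.equiv (Fin n) ℝ).toHomeomorph.isCompact_preimage.mpr isCompact_Icc
  exact ((measure_mono hsub).trans_lt hcomp.measure_lt_top).ne

lemma eAvg_eq_lintegral {n : ℕ} (f : Euc n → ℝ) (c : Euc n) (h : ℝ) :
    eAvg f c h =
      ∫⁻ x, ENNReal.ofReal (f x) ∂((volume (cube c h))⁻¹ • volume.restrict (cube c h)) := by
  rw [eAvg, lintegral_smul_measure, smul_eq_mul, ENNReal.div_eq_inv_mul]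

lemma eAvg_one {n : ℕ} (c : Euc n) {h : ℝ} (hh : 0 < h) : eAvg (fun _ => 1) c h = 1 := by
  simp [eAvg, ENNReal.div_self (volume_cube_ne_zero c hh) (volume_cube_ne_top c h)]

/-- Hölder's inequality for averages over a cube. -/
lemma eAvg_rpow_le_mul_prod {n : ℕ} {ι : Type*} (c : Euc n) (h : ℝ) (s : Finset ι)
    {F g₀ : Euc n → ℝ} {g : ι → Euc n → ℝ} {a₀ A : ℝ} {a : ι → ℝ}
    (hg₀ : AEMeasurable g₀) (hg : ∀ i ∈ s, AEMeasurable (g i))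
    (ha₀ : 0 ≤ a₀) (ha : ∀ i ∈ s, 0 ≤ a i) (hA : 0 < A) (hsum : a₀ + ∑ i ∈ s, a i = A)
    (hF : ∀ᵐ x, 0 < g₀ x ∧ (∀ i ∈ s, 0 < g i x) ∧
      F x = g₀ x ^ (a₀ / A) * ∏ i ∈ s, g i x ^ (a i / A)) :
    eAvg F c h ^ A ≤ eAvg g₀ c h ^ a₀ * ∏ i ∈ s, eAvg (g i) c h ^ a i := by
  set μ : Measure (Euc n) := (volume (cube c h))⁻¹ • volume.restrict (cube c h)
  have hμ : μ ≪ volume :=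
    Measure.restrict_le_self.absolutelyContinuous.smul_left _
  have key := ENNReal.lintegral_mul_prod_norm_pow_le (μ := μ) s
    (g := fun x => ENNReal.ofReal (g₀ x)) (f := fun i x => ENNReal.ofReal (g i x))
    (hg₀.mono_ac hμ).ennreal_ofReal
    (fun i hi => ((hg i hi).mono_ac hμ).ennreal_ofReal)
    (q := a₀ / A) (p := fun i => a i / A)
    (by rw [← Finset.sum_div, ← add_div, hsum, div_self hA.ne'])
    (by positivity) (fun i hi => div_nonneg (ha i hi) hA.le)
  have hFint : eAvg F c h = ∫⁻ x, ENNReal.ofReal (g₀ x) ^ (a₀ / A) *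
      ∏ i ∈ s, ENNReal.ofReal (g i x) ^ (a i / A) ∂μ := by
    rw [eAvg_eq_lintegral]
    refine lintegral_congr_ae ?_
    filter_upwards [hμ.ae_le hF] with x hx
    obtain ⟨h0, hi, hx⟩ := hx
    rw [hx, ENNReal.ofReal_mul (by positivity), ENNReal.ofReal_rpow_of_pos h0,
      ENNReal.ofReal_prod_of_nonneg fun i his => Real.rpow_nonneg (hi i his).le _]
    congr 1
    exact Finset.prod_congr rfl fun i his => (ENNReal.ofReal_rpow_of_pos (hi i his)).symm
  calc eAvg F c h ^ A
      ≤ (eAvg g₀ c h ^ (a₀ / A) * ∏ i ∈ s, eAvg (g i) c h ^ (a i / A)) ^ A := by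
        rw [hFint]
        simp only [eAvg_eq_lintegral]
        exact ENNReal.rpow_le_rpow key hA.le
    _ = _ := by
        rw [ENNReal.mul_rpow_of_nonneg _ _ hA.le, ← ENNReal.prod_rpow_of_nonneg hA.le,
          ← ENNReal.rpow_mul, div_mul_cancel₀ _ hA.ne']
        congr 1
        refine Finset.prod_congr rfl fun i _ => ?_
        rw [← ENNReal.rpow_mul, div_mul_cancel₀ _ hA.ne']

lemma one_sub_conjExp {q : ℝ} (hq : 1 < q) : 1 - conjExp q = -(q - 1)⁻¹ := by
  have : q - 1 ≠ 0 := by linarith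
  rw [conjExp]
  field_simp
  ring

lemma inv_conjExp {q : ℝ} (hq : 1 < q) : (conjExp q)⁻¹ = 1 - 1 / q := by
  have : q - 1 ≠ 0 := by linarith
  have : q ≠ 0 := by linarith
  rw [conjExp]
  field_simp

lemma one_sub_conjExp_mul_inv {q : ℝ} (hq : 1 < q) :
    (1 - conjExp q) * (conjExp q)⁻¹ = -(1 / q) := by
  have : q - 1 ≠ 0 := by linarith
  have : q ≠ 0 := by linarith
  rw [conjExp]
  field_simp
  ring

lemma one_lt_conjExp {q : ℝ} (hq : 1 < q) : 1 < conjExp q := by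
  rw [conjExp, lt_div_iff₀ (by linarith)]
  linarith

lemma apRatio_rpow_inv {n : ℕ} {m q : ℝ} (hq : 0 < q) (w : Euc n → ℝ) (c : Euc n) (h : ℝ) :
    apRatio (m * q) w c h ^ q⁻¹ = eAvg w c h ^ q⁻¹ *
      eAvg (fun x => w x ^ (1 - conjExp (m * q))) c h ^ (m - q⁻¹) := by
  rw [apRatio, ENNReal.mul_rpow_of_nonneg _ _ (by positivity), ← ENNReal.rpow_mul]
  congr 2
  field_simp

lemma apRatio_le_apConst {n : ℕ} (q : ℝ) (w : Euc n → ℝ) (c : Euc n) {h : ℝ} (hh : 0 < h) :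
    apRatio q w c h ≤ apConst n q w :=
  le_iSup_of_le c (le_iSup₂_of_le h hh le_rfl)

lemma multiRatio_le_multiConst {n m : ℕ} (p : Fin m → ℝ) (p₀ : ℝ) (w : Fin m → Euc n → ℝ)
    (c : Euc n) {h : ℝ} (hh : 0 < h) : multiRatio p p₀ w c h ≤ multiConst n p p₀ w :=
  le_iSup_of_le c (le_iSup₂_of_le h hh le_rfl)

lemma apConst_lt_top_of_rpow_le {n : ℕ} {r q : ℝ} (hq : 0 < q) {w : Euc n → ℝ} {C : ℝ≥0∞}
    (hC : C < ⊤) (H : ∀ c h, 0 < h → apRatio r w c h ^ q⁻¹ ≤ C) : apConst n r w < ⊤ := by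
  refine lt_of_le_of_lt (b := C ^ q) ?_ (ENNReal.rpow_lt_top_of_nonneg hq.le hC.ne)
  refine iSup_le fun c => iSup₂_le fun h hh => ?_
  exact (ENNReal.rpow_inv_le_iff hq).mp (H c h hh)

lemma ae_exists_eq_exp {n m : ℕ} {w : Fin m → Euc n → ℝ} (hw : ∀ j, IsWeight (w j)) :
    ∀ᵐ x : Euc n, ∃ u : Fin m → ℝ, ∀ j, w j x = Real.exp (u j) := by
  filter_upwards [ae_all_iff.mpr fun j => (hw j).2] with x hx
  exact ⟨fun j => Real.log (w j x), fun j => (Real.exp_log (hx j)).symm⟩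

lemma IsWeight.aemeasurable_rpow {n : ℕ} {w : Euc n → ℝ} (hw : IsWeight w) (r : ℝ) :
    AEMeasurable fun x => w x ^ r :=
  hw.1.aestronglyMeasurable.aemeasurable.pow_const r

section Ratios

variable {n m : ℕ} {p : Fin m → ℝ} {p₀ : ℝ} {w : Fin m → Euc n → ℝ}

lemma aemeasurable_prod_rpow (hw : ∀ j, IsWeight (w j)) :
    AEMeasurable fun x => ∏ j, w j x ^ (p₀ / p j) :=
  Finset.aemeasurable_fun_prod _ fun j _ => (hw j).aemeasurable_rpow _

lemma pos_of_inv_eq_sum (hm : 1 ≤ m) (hp : ∀ j, 1 < p j) (hp₀ : 1 / p₀ = ∑ j, 1 / p j) :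
    0 < p₀ := by
  have : Nonempty (Fin m) := ⟨⟨0, hm⟩⟩
  rw [← one_div_pos, hp₀]
  exact Finset.sum_pos (fun j _ => one_div_pos.mpr (zero_lt_one.trans (hp j)))
    Finset.univ_nonempty

lemma sum_inv_conjExp (hp : ∀ j, 1 < p j) (hp₀ : 1 / p₀ = ∑ j, 1 / p j) :
    ∑ j, (conjExp (p j))⁻¹ = m - p₀⁻¹ := by
  simp [inv_conjExp (hp _), ← one_div, hp₀]

lemma inv_lt_card (hm : 1 ≤ m) (hp : ∀ j, 1 < p j) (hp₀ : 1 / p₀ = ∑ j, 1 / p j) :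
    0 < m - p₀⁻¹ := by
  have : Nonempty (Fin m) := ⟨⟨0, hm⟩⟩
  rw [← sum_inv_conjExp hp hp₀]
  exact Finset.sum_pos
    (fun j _ => inv_pos.mpr (zero_lt_one.trans (one_lt_conjExp (hp j)))) Finset.univ_nonempty

lemma one_sub_conjExp_mul_mul {a q : ℝ} (hq : 0 < q) (ha : 0 < a - q⁻¹) :
    (1 - conjExp (a * q)) * (a - q⁻¹) = -q⁻¹ := by
  have h : 0 < a * q - 1 := by
    have := mul_pos ha hq
    rwa [sub_mul, inv_mul_cancel₀ hq.ne'] at this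
  rw [one_sub_conjExp (by linarith)]
  field_simp

lemma one_le_apRatio_dual_prod (hm : 1 ≤ m) (hp : ∀ j, 1 < p j)
    (hp₀ : 1 / p₀ = ∑ j, 1 / p j) (hw : ∀ j, IsWeight (w j)) (c : Euc n) {h : ℝ} (hh : 0 < h) :
    1 ≤ eAvg (fun x => (∏ j, w j x ^ (p₀ / p j)) ^ (1 - conjExp (m * p₀))) c h ^ (m - p₀⁻¹) *
      ∏ j, eAvg (fun x => (w j x ^ (1 - conjExp (p j))) ^ (1 - conjExp (m * conjExp (p j)))) c h ^
        (m - (conjExp (p j))⁻¹) := by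
  have hp₀pos := pos_of_inv_eq_sum hm hp hp₀
  have hA₀ := inv_lt_card hm hp hp₀
  have hm' : (1 : ℝ) ≤ m := by exact_mod_cast hm
  have hA : ∀ j, 0 < m - (conjExp (p j))⁻¹ := fun j => by
    have := inv_lt_one_of_one_lt₀ (one_lt_conjExp (hp j))
    linarith
  have hS : 0 < (m - p₀⁻¹) + ∑ j, (m - (conjExp (p j))⁻¹) :=
    add_pos_of_pos_of_nonneg hA₀ (Finset.sum_nonneg fun j _ => (hA j).le)
  refine le_trans (by rw [eAvg_one c hh, ENNReal.one_rpow]) (eAvg_rpow_le_mul_prod c h Finset.univ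
    (F := fun _ => 1) ((aemeasurable_prod_rpow hw).pow_const _)
    (fun j _ => ((hw j).aemeasurable_rpow _).pow_const _) hA₀.le (fun j _ => (hA j).le) hS rfl ?_)
  filter_upwards [ae_exists_eq_exp hw] with x ⟨u, hu⟩
  simp only [hu]
  refine ⟨by positivity, fun j _ => by positivity, ?_⟩
  simp only [← Real.exp_mul, ← Real.exp_sum, ← Real.exp_add]
  rw [eq_comm, Real.exp_eq_one_iff, mul_assoc, mul_div_assoc', one_sub_conjExp_mul_mul hp₀pos hA₀,
    Finset.sum_mul, ← Finset.sum_add_distrib]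
  refine Finset.sum_eq_zero fun j _ => ?_
  have hq := zero_lt_one.trans (one_lt_conjExp (hp j))
  rw [mul_assoc (u j * _), mul_div_assoc' (1 - conjExp (m * conjExp (p j))),
    one_sub_conjExp_mul_mul hq (hA j)]
  have h1 := one_sub_conjExp_mul_inv (hp j)
  have : p j ≠ 0 := by linarith [hp j]
  calc _ = - (u j / ((m - p₀⁻¹) + ∑ j, (m - (conjExp (p j))⁻¹))) *
          (p₀ * p₀⁻¹ * (1 / p j) + (1 - conjExp (p j)) * (conjExp (p j))⁻¹) := by ring
    _ = 0 := by rw [h1, mul_inv_cancel₀ hp₀pos.ne']; ring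

lemma apRatio_prod_rpow_le_multiRatio (hm : 1 ≤ m) (hp : ∀ j, 1 < p j)
    (hp₀ : 1 / p₀ = ∑ j, 1 / p j) (hw : ∀ j, IsWeight (w j)) (c : Euc n) (h : ℝ) :
    apRatio (m * p₀) (fun x => ∏ j, w j x ^ (p₀ / p j)) c h ^ p₀⁻¹ ≤ multiRatio p p₀ w c h := by
  have hp₀pos := pos_of_inv_eq_sum hm hp hp₀
  have hA₀ := inv_lt_card hm hp hp₀
  rw [apRatio_rpow_inv hp₀pos, multiRatio, one_div]
  gcongr
  refine (eAvg_rpow_le_mul_prod c h Finset.univ (g₀ := fun _ => 1) (a₀ := 0)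
    (g := fun j x => w j x ^ (1 - conjExp (p j))) (a := fun j => (conjExp (p j))⁻¹)
    aemeasurable_const (fun j _ => (hw j).aemeasurable_rpow _) le_rfl
    (fun j _ => inv_nonneg.mpr (zero_lt_one.trans (one_lt_conjExp (hp j))).le) hA₀
    (by rw [zero_add, sum_inv_conjExp hp hp₀]) ?_).trans_eq (by simp)
  filter_upwards [ae_exists_eq_exp hw] with x ⟨u, hu⟩
  simp only [hu]
  refine ⟨one_pos, fun j _ => by positivity, ?_⟩
  simp only [← Real.exp_mul, ← Real.exp_sum, Real.one_rpow, one_mul]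
  congr 1
  rw [eq_div_of_mul_eq hA₀.ne' (one_sub_conjExp_mul_mul hp₀pos hA₀), Finset.sum_mul]
  refine Finset.sum_congr rfl fun j _ => ?_
  have h1 := one_sub_conjExp_mul_inv (hp j)
  calc _ = u j / (m - p₀⁻¹) * (p₀ * p₀⁻¹) * (-(1 / p j)) := by ring
    _ = _ := by rw [← h1, mul_inv_cancel₀ hp₀pos.ne']; ring

lemma apRatio_rpow_le_multiRatio (hm : 1 ≤ m) (hp : ∀ j, 1 < p j)
    (hp₀ : 1 / p₀ = ∑ j, 1 / p j) (hw : ∀ j, IsWeight (w j)) (c : Euc n) (h : ℝ) (j : Fin m) :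
    apRatio (m * conjExp (p j)) (fun x => w j x ^ (1 - conjExp (p j))) c h ^ (conjExp (p j))⁻¹ ≤
      multiRatio p p₀ w c h := by
  have hp₀pos := pos_of_inv_eq_sum hm hp hp₀
  have hq := zero_lt_one.trans (one_lt_conjExp (hp j))
  have hm' : (1 : ℝ) ≤ m := by exact_mod_cast hm
  have hA : 0 < m - (conjExp (p j))⁻¹ := by
    have := inv_lt_one_of_one_lt₀ (one_lt_conjExp (hp j))
    linarith
  rw [apRatio_rpow_inv hq, multiRatio, one_div, ← Finset.mul_prod_erase _ _ (Finset.mem_univ j),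
    mul_left_comm]
  gcongr
  refine eAvg_rpow_le_mul_prod c h (Finset.univ.erase j) (aemeasurable_prod_rpow hw)
    (fun i _ => (hw i).aemeasurable_rpow _) (by positivity)
    (fun i _ => inv_nonneg.mpr (zero_lt_one.trans (one_lt_conjExp (hp i))).le) hA ?_ ?_
  · have := sum_inv_conjExp hp hp₀
    rw [← Finset.add_sum_erase _ _ (Finset.mem_univ j)] at this
    linarith
  filter_upwards [ae_exists_eq_exp hw] with x ⟨u, hu⟩
  simp only [hu]
  refine ⟨by positivity, fun i _ => by positivity, ?_⟩
  simp only [← Real.exp_mul, ← Real.exp_sum, ← Real.exp_add]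
  congr 1
  rw [eq_div_of_mul_eq hA.ne' (one_sub_conjExp_mul_mul hq hA), Finset.sum_mul,
    ← Finset.add_sum_erase _ _ (Finset.mem_univ j), add_assoc, ← Finset.sum_add_distrib,
    Finset.sum_eq_zero]
  · calc _ = - (u j / (m - (conjExp (p j))⁻¹)) * ((1 - conjExp (p j)) * (conjExp (p j))⁻¹) := by
          ring
      _ = u j / (m - (conjExp (p j))⁻¹) * (1 / p j) * (p₀ * p₀⁻¹) := by
          rw [one_sub_conjExp_mul_inv (hp j), mul_inv_cancel₀ hp₀pos.ne']; ring
      _ = _ := by ring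
  · intro i _
    calc _ = u i / (m - (conjExp (p j))⁻¹) *
            (p₀ * p₀⁻¹ * (1 / p i) + (1 - conjExp (p i)) * (conjExp (p i))⁻¹) := by ring
      _ = 0 := by rw [one_sub_conjExp_mul_inv (hp i), mul_inv_cancel₀ hp₀pos.ne']; ring

lemma multiRatio_le_apRatio_mul_prod (hm : 1 ≤ m) (hp : ∀ j, 1 < p j)
    (hp₀ : 1 / p₀ = ∑ j, 1 / p j) (hw : ∀ j, IsWeight (w j)) (c : Euc n) {h : ℝ} (hh : 0 < h) :
    multiRatio p p₀ w c h ≤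
      apRatio (m * p₀) (fun x => ∏ j, w j x ^ (p₀ / p j)) c h ^ p₀⁻¹ *
        ∏ j, apRatio (m * conjExp (p j)) (fun x => w j x ^ (1 - conjExp (p j))) c h ^
          (conjExp (p j))⁻¹ := by
  simp only [apRatio_rpow_inv (pos_of_inv_eq_sum hm hp hp₀),
    apRatio_rpow_inv (zero_lt_one.trans (one_lt_conjExp (hp _))), Finset.prod_mul_distrib]
  rw [mul_mul_mul_comm, multiRatio, one_div]
  exact le_mul_of_one_le_right' (one_le_apRatio_dual_prod hm hp hp₀ hw c hh)

end Ratios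

/-- Lerner–Ombrosi–Pérez–Torres–Trujillo-González characterization of
multiple weights. With `1/p = Σ_j 1/p_j` and `ν = ∏_j ω_j^{p/p_j}`,
`ω⃗ ∈ A_{P⃗}` iff `ω_j^{1-p_j'} ∈ A_{m p_j'}` for all `j` and `ν ∈ A_{mp}`. -/
theorem multiple_weight_characterization (n : ℕ) (m : ℕ) (hm : 1 ≤ m)
    (p : Fin m → ℝ) (hp : ∀ j, 1 < p j) (p₀ : ℝ) (hp₀ : 1 / p₀ = ∑ j, 1 / p j)
    (w : Fin m → Euc n → ℝ) (hw : ∀ j, IsWeight (w j)) :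
    multiConst n p p₀ w < ⊤ ↔
      ((∀ j, apConst n ((m : ℝ) * conjExp (p j)) (fun x => w j x ^ (1 - conjExp (p j))) < ⊤) ∧
        apConst n ((m : ℝ) * p₀) (fun x => ∏ j, w j x ^ (p₀ / p j)) < ⊤) := by
  have hp₀pos := pos_of_inv_eq_sum hm hp hp₀
  constructor
  · intro H
    refine ⟨fun j => apConst_lt_top_of_rpow_le (zero_lt_one.trans (one_lt_conjExp (hp j))) H
      fun c h hh => (apRatio_rpow_le_multiRatio hm hp hp₀ hw c h j).trans
        (multiRatio_le_multiConst p p₀ w c hh),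
      apConst_lt_top_of_rpow_le hp₀pos H fun c h hh =>
        (apRatio_prod_rpow_le_multiRatio hm hp hp₀ hw c h).trans
          (multiRatio_le_multiConst p p₀ w c hh)⟩
  · rintro ⟨H, H₀⟩
    have hq : ∀ j, 0 ≤ (conjExp (p j))⁻¹ := fun j =>
      inv_nonneg.mpr (zero_lt_one.trans (one_lt_conjExp (hp j))).le
    refine lt_of_le_of_lt (iSup_le fun c => iSup₂_le fun h hh =>
      (multiRatio_le_apRatio_mul_prod hm hp hp₀ hw c hh).trans ?_)
      (ENNReal.mul_lt_top (ENNReal.rpow_lt_top_of_nonneg (inv_nonneg.mpr hp₀pos.le) H₀.ne)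
        (ENNReal.prod_lt_top (s := Finset.univ) fun j _ =>
           ENNReal.rpow_lt_top_of_nonneg (hq j) (H j).ne))
    gcongr with j
    · exact apRatio_le_apConst _ _ c hh
    · exact hq j
    · exact apRatio_le_apConst _ _ c hh
end
end
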